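/- For the one-sided test with the adaptive g-prior (taking g → ∞, which maximizes B01 when θ̂ ≤ 0 and maximizes B10 when θ̂ ≰ 0), the limiting posterior of θ is a multivariate Student-t distribution with location θ̂, scale matrix (n−r2)^{−1} s_y² Q⁻¹ and n−r2 degrees of freedom, and the resulting one-sided Bayes factor is information consistent: letting P(θ̂) denote the negative-orthant probability of this multivariate Student-t with location θ̂, we have P(θ̂) → 0 (hence B10 = (P_π(θ ≤ 0 | σ²=1)^{−1} − 1)^{−1}(P(θ̂)^{−1} − 1) → ∞) as |θ̂| → ∞ with at least one coordinate of θ̂ going to +∞, and P(θ̂) → 1 (hence B10 → 0) as all coordinates of θ̂ go to −∞. -/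

import Mathlib

open MeasureTheory Filter Matrix

noncomputable section

/-- The closed negative orthant of ℝ^r. -/
def negOrthant (r : ℕ) : Set (EuclideanSpace ℝ (Fin r)) := {ξ | ∀ i, ξ i ≤ 0}

/-- Density of the multivariate Student-t distribution on ℝ^r with location m,
positive definite scale matrix S and d degrees of freedom. -/
def mvtDensity (r : ℕ) (d : ℝ) (m : EuclideanSpace ℝ (Fin r))
    (S : Matrix (Fin r) (Fin r) ℝ) (ξ : EuclideanSpace ℝ (Fin r)) : ℝ :=
  Real.Gamma ((d + r) / 2) / (Real.Gamma (d / 2) * (d * Real.pi) ^ ((r:ℝ) / 2)) *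
    S.det ^ (-(1:ℝ)/2) *
    (1 + (ξ - m) ⬝ᵥ (S⁻¹).mulVec (ξ - m) / d) ^ (-((d + (r:ℝ)) / 2))

/-- Negative-orthant probability of the multivariate Student-t distribution. -/
def mvtNegOrthantProb (r : ℕ) (d : ℝ) (m : EuclideanSpace ℝ (Fin r))
    (S : Matrix (Fin r) (Fin r) ℝ) : ℝ :=
  ∫ ξ in negOrthant r, mvtDensity r d m S ξ

lemma aux_gauss (r : ℕ) (Q : Matrix (Fin r) (Fin r) ℝ) (hQ : Q.PosDef) (t : ℝ) (ht : 0 < t) :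
    ∫ x : EuclideanSpace ℝ (Fin r), Real.exp (-(t * (x.ofLp ⬝ᵥ Q *ᵥ x.ofLp)))
      = (Real.pi / t) ^ ((r:ℝ) / 2) * Q.det ^ (-(1:ℝ)/2) := by
  obtain ⟨B, hB⟩ : ∃ B : Matrix (Fin r) (Fin r) ℝ, Q = Bᵀ * B := by
    open scoped MatrixOrder in
    obtain ⟨B, hB⟩ := CStarAlgebra.nonneg_iff_eq_star_mul_self.1 hQ.posSemidef.nonneg
    exact ⟨B, by simpa [Matrix.star_eq_conjTranspose] using hB⟩
  have hdet : Q.det = B.det ^ 2 := by rw [hB, det_mul, det_transpose]; ring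
  have hQd := hQ.det_pos
  have hBd : B.det ≠ 0 := by
    intro h; rw [h] at hdet; simp at hdet; linarith
  have hL : LinearMap.det (Matrix.toEuclideanLin B) = B.det := by
    simp
  have hmap := MeasureTheory.Measure.map_linearMap_addHaar_eq_smul_addHaar
    (volume : Measure (EuclideanSpace ℝ (Fin r))) (f := Matrix.toEuclideanLin B) (by rw [hL]; exact hBd)
  have key : ∀ x : EuclideanSpace ℝ (Fin r),
      Real.exp (-(t * (x.ofLp ⬝ᵥ Q *ᵥ x.ofLp))) =
        (fun y : EuclideanSpace ℝ (Fin r) => Real.exp (-t * ‖y‖ ^ 2)) (Matrix.toEuclideanLin B x) := by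
    intro x
    have : ‖Matrix.toEuclideanLin B x‖ ^ 2 = x.ofLp ⬝ᵥ Q *ᵥ x.ofLp := by
      rw [EuclideanSpace.real_norm_sq_eq, hB, ← Matrix.mulVec_mulVec, Matrix.dotProduct_mulVec,
        Matrix.vecMul_transpose]
      simp [dotProduct, sq]
    simp only [this]
    ring_nf
  simp_rw [key]
  have hcont : Continuous (Matrix.toEuclideanLin B) := LinearMap.continuous_of_finiteDimensional _
  rw [← MeasureTheory.integral_map (φ := Matrix.toEuclideanLin B)
    (f := fun y : EuclideanSpace ℝ (Fin r) => Real.exp (-t * ‖y‖ ^ 2)) hcont.aemeasurable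
    (by apply Continuous.aestronglyMeasurable; fun_prop), hmap, integral_smul_measure,
    GaussianFourier.integral_rexp_neg_mul_sq_norm ht, hL, hdet]
  rw [ENNReal.toReal_ofReal (abs_nonneg _), smul_eq_mul, mul_comm]
  congr 1
  · simp
  · rw [← sq_abs, ← Real.rpow_natCast, ← Real.rpow_mul (abs_nonneg _), abs_inv,
      ← Real.rpow_neg_one]
    norm_num

lemma aux_quad_nonneg (r : ℕ) (Q : Matrix (Fin r) (Fin r) ℝ) (hQ : Q.PosDef) (x : Fin r → ℝ) :
    0 ≤ x ⬝ᵥ Q *ᵥ x := by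
  simpa using hQ.posSemidef.dotProduct_mulVec_nonneg x

lemma aux_quad_cont (r : ℕ) (Q : Matrix (Fin r) (Fin r) ℝ) :
    Continuous (fun x : EuclideanSpace ℝ (Fin r) => x.ofLp ⬝ᵥ Q *ᵥ x.ofLp) := by
  fun_prop

lemma aux_gauss_int (r : ℕ) (Q : Matrix (Fin r) (Fin r) ℝ) (hQ : Q.PosDef) (t : ℝ) (ht : 0 < t) :
    Integrable (fun x : EuclideanSpace ℝ (Fin r) =>
      Real.exp (-(t * (x.ofLp ⬝ᵥ Q *ᵥ x.ofLp)))) := by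
  apply Integrable.of_integral_ne_zero
  rw [aux_gauss r Q hQ t ht]
  have := hQ.det_pos
  have := Real.pi_pos
  positivity

lemma aux_student (r : ℕ) (Q : Matrix (Fin r) (Fin r) ℝ) (hQ : Q.PosDef) (d : ℝ) (hd : 0 < d) :
    Integrable (fun x : EuclideanSpace ℝ (Fin r) =>
      (1 + (x.ofLp ⬝ᵥ Q *ᵥ x.ofLp)) ^ (-((d + (r:ℝ)) / 2))) ∧
    ∫ x : EuclideanSpace ℝ (Fin r), (1 + (x.ofLp ⬝ᵥ Q *ᵥ x.ofLp)) ^ (-((d + (r:ℝ)) / 2))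
      = Real.Gamma (d / 2) / Real.Gamma ((d + r) / 2) * Real.pi ^ ((r:ℝ) / 2)
        * Q.det ^ (-(1:ℝ)/2) := by
  set a : ℝ := (d + r) / 2 with ha_def
  have hr0 : (0:ℝ) ≤ r := Nat.cast_nonneg r
  have ha : 0 < a := by positivity
  have hG : 0 < Real.Gamma a := Real.Gamma_pos_of_pos ha
  let F : EuclideanSpace ℝ (Fin r) → ℝ → ℝ := fun x t =>
    t ^ (a - 1) * Real.exp (-((1 + (x.ofLp ⬝ᵥ Q *ᵥ x.ofLp)) * t))
  have hF1 : ∀ x, ∫ t in Set.Ioi (0:ℝ), F x t =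
      (1 + (x.ofLp ⬝ᵥ Q *ᵥ x.ofLp)) ^ (-a) * Real.Gamma a := by
    intro x
    have h0 := aux_quad_nonneg r Q hQ x.ofLp
    rw [Real.integral_rpow_mul_exp_neg_mul_Ioi ha (by linarith), one_div,
      Real.inv_rpow (by linarith), Real.rpow_neg (by linarith)]
  have hsplit : ∀ (x : EuclideanSpace ℝ (Fin r)) (t : ℝ), F x t = (t ^ (a - 1) * Real.exp (-t)) *
      Real.exp (-(t * (x.ofLp ⬝ᵥ Q *ᵥ x.ofLp))) := by
    intro x t
    simp only [F]
    rw [mul_assoc, ← Real.exp_add]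
    congr 2; ring
  have hF2 : ∀ t ∈ Set.Ioi (0:ℝ), ∫ x, F x t =
      (t ^ (d / 2 - 1) * Real.exp (-(1 * t))) * (Real.pi ^ ((r:ℝ) / 2) * Q.det ^ (-(1:ℝ)/2)) := by
    intro t ht
    have ht : 0 < t := ht
    simp_rw [hsplit]
    rw [integral_const_mul, aux_gauss r Q hQ t ht, Real.div_rpow Real.pi_pos.le ht.le]
    have : t ^ (a - 1) = t ^ (d / 2 - 1) * t ^ ((r:ℝ)/2) := by
      rw [← Real.rpow_add ht]; congr 1; rw [ha_def]; ring
    rw [this, one_mul]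
    have : t ^ ((r:ℝ)/2) ≠ 0 := (Real.rpow_pos_of_pos ht _).ne'
    field_simp
  have hmeas : Measurable (Function.uncurry F) := by
    have h1 := (aux_quad_cont r Q).measurable
    have h2 : Measurable (fun p : EuclideanSpace ℝ (Fin r) × ℝ =>
      p.2 ^ (a - 1) * Real.exp (-((1 + (p.1.ofLp ⬝ᵥ Q *ᵥ p.1.ofLp)) * p.2))) := by
      have h4 : Measurable (fun p : EuclideanSpace ℝ (Fin r) × ℝ =>
        (p.1.ofLp ⬝ᵥ Q *ᵥ p.1.ofLp)) := h1.comp measurable_fst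
      exact (measurable_snd.pow_const _).mul
        (((measurable_const.add h4).mul measurable_snd).neg.exp)
    exact h2
  have hgam : Integrable (fun t : ℝ => (t ^ (d / 2 - 1) * Real.exp (-(1 * t))) *
      (Real.pi ^ ((r:ℝ) / 2) * Q.det ^ (-(1:ℝ)/2))) (volume.restrict (Set.Ioi 0)) := by
    apply Integrable.mul_const
    apply Integrable.of_integral_ne_zero
    rw [Real.integral_rpow_mul_exp_neg_mul_Ioi (by positivity) one_pos]
    have := Real.Gamma_pos_of_pos (half_pos hd)
    simp; positivity
  have hint : Integrable (Function.uncurry F) (volume.prod (volume.restrict (Set.Ioi (0:ℝ)))) := by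
    rw [integrable_prod_iff' hmeas.aestronglyMeasurable]
    constructor
    · filter_upwards [ae_restrict_mem measurableSet_Ioi] with t ht
      simp only [Function.uncurry_apply_pair, hsplit]
      exact (aux_gauss_int r Q hQ t ht).const_mul _
    · refine hgam.congr ?_
      filter_upwards [ae_restrict_mem measurableSet_Ioi] with t ht
      rw [← hF2 t ht]
      congr 1; ext x
      have ht : 0 < t := ht
      simp only [Function.uncurry_apply_pair, F]
      rw [Real.norm_of_nonneg (by positivity)]
  have hI := hint.integral_prod_left
  simp only [Function.uncurry_apply_pair, hF1] at hI
  have hsw := integral_integral_swap hint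
  simp only [hF1] at hsw
  rw [setIntegral_congr_fun measurableSet_Ioi hF2, integral_mul_const, integral_mul_const,
    Real.integral_rpow_mul_exp_neg_mul_Ioi (by positivity) one_pos] at hsw
  constructor
  · have := hI.mul_const (Real.Gamma a)⁻¹
    refine this.congr (Eventually.of_forall fun x => ?_)
    simp only
    field_simp
  · rw [eq_comm, ← mul_left_inj' hG.ne', hsw]
    simp
    field_simp

lemma aux_dens (r : ℕ) (d : ℝ) (m ξ : EuclideanSpace ℝ (Fin r)) (Q : Matrix (Fin r) (Fin r) ℝ)
    (hQ : Q.PosDef) (c : ℝ) (hc : 0 < c) :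
    mvtDensity r d m (c • Q⁻¹) ξ =
      Real.Gamma ((d + r) / 2) / (Real.Gamma (d / 2) * (d * Real.pi) ^ ((r:ℝ) / 2)) *
      (c ^ r * Q.det⁻¹) ^ (-(1:ℝ)/2) *
      (1 + (c⁻¹ * ((ξ - m).ofLp ⬝ᵥ Q *ᵥ (ξ - m).ofLp)) / d) ^ (-((d + (r:ℝ)) / 2)) := by
  have hu : IsUnit Q.det := hQ.det_pos.ne'.isUnit
  have h1 : (c • Q⁻¹)⁻¹ = c⁻¹ • Q := by
    apply Matrix.inv_eq_right_inv
    rw [smul_mul_smul_comm, mul_inv_cancel₀ hc.ne', Matrix.nonsing_inv_mul _ hu, one_smul]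
  unfold mvtDensity
  rw [h1, Matrix.det_smul, Matrix.det_nonsing_inv, Ring.inverse_eq_inv', Fintype.card_fin,
    Matrix.smul_mulVec, dotProduct_smul, smul_eq_mul]
  rfl

lemma aux_dens_int (r : ℕ) (d : ℝ) (hd : 0 < d) (Q : Matrix (Fin r) (Fin r) ℝ)
    (hQ : Q.PosDef) (c : ℝ) (hc : 0 < c) :
    Integrable (mvtDensity r d 0 (c • Q⁻¹)) ∧ ∫ x, mvtDensity r d 0 (c • Q⁻¹) x = 1 := by
  have hcd : 0 < c⁻¹ / d := by positivity
  have hQ' : ((c⁻¹ / d) • Q).PosDef := hQ.smul hcd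
  obtain ⟨h1, h2⟩ := aux_student r _ hQ' d hd
  have hdet := hQ.det_pos
  have he : mvtDensity r d 0 (c • Q⁻¹) = fun x =>
      Real.Gamma ((d + r) / 2) / (Real.Gamma (d / 2) * (d * Real.pi) ^ ((r:ℝ) / 2)) *
      (c ^ r * Q.det⁻¹) ^ (-(1:ℝ)/2) *
      (1 + x.ofLp ⬝ᵥ ((c⁻¹ / d) • Q) *ᵥ x.ofLp) ^ (-((d + (r:ℝ)) / 2)) := by
    ext x
    rw [aux_dens r d 0 x Q hQ c hc, sub_zero, Matrix.smul_mulVec, dotProduct_smul, smul_eq_mul]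
    congr 3
    ring
  rw [he]
  refine ⟨h1.const_mul _, ?_⟩
  rw [integral_const_mul, h2, Matrix.det_smul, Fintype.card_fin]
  have hG1 := Real.Gamma_pos_of_pos (half_pos hd)
  have hG2 : 0 < Real.Gamma ((d + r) / 2) := Real.Gamma_pos_of_pos (by positivity)
  have hpi := Real.pi_pos
  rw [Real.mul_rpow hd.le hpi.le]
  have h3 : (c ^ r * Q.det⁻¹) ^ (-(1:ℝ)/2) * ((c⁻¹ / d) ^ r * Q.det) ^ (-(1:ℝ)/2)
      = d ^ ((r:ℝ)/2) := by
    rw [← Real.mul_rpow (by positivity) (by positivity)]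
    have : c ^ r * Q.det⁻¹ * ((c⁻¹ / d) ^ r * Q.det) = d ^ (-(r:ℝ)) := by
      rw [Real.rpow_neg hd.le, Real.rpow_natCast]
      field_simp
      rw [mul_comm, ← mul_pow]; field_simp
      simp [hd.ne']
    rw [this, ← Real.rpow_mul hd.le]
    congr 1; ring
  have hp1 : 0 < d ^ ((r:ℝ)/2) := by positivity
  have hp2 : 0 < Real.pi ^ ((r:ℝ)/2) := by positivity
  calc _ = ((c ^ r * Q.det⁻¹) ^ (-(1:ℝ)/2) * ((c⁻¹ / d) ^ r * Q.det) ^ (-(1:ℝ)/2)) / d ^ ((r:ℝ)/2) := by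
        field_simp
    _ = 1 := by rw [h3]; field_simp

lemma aux_closed (r : ℕ) : IsClosed (negOrthant r) := by
  have : negOrthant r = ⋂ i, {ξ : EuclideanSpace ℝ (Fin r) | ξ i ≤ 0} := by
    ext; simp [negOrthant]
  rw [this]
  exact isClosed_iInter fun i => isClosed_le (by fun_prop) continuous_const

lemma aux_vol_pos (r : ℕ) : 0 < volume (negOrthant r) := by
  have ho : IsOpen {ξ : EuclideanSpace ℝ (Fin r) | ∀ i, ξ i < 0} := by
    have : {ξ : EuclideanSpace ℝ (Fin r) | ∀ i, ξ i < 0} = ⋂ i, {ξ | ξ i < 0} := by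
      ext; simp
    rw [this]
    exact isOpen_iInter_of_finite fun i => isOpen_lt (by fun_prop) continuous_const
  refine (ho.measure_pos volume ⟨WithLp.toLp 2 (fun _ => -1), by simp⟩).trans_le
    (measure_mono fun x hx i => (hx i).le)

lemma aux_vol_compl_pos (r : ℕ) (hr : 1 ≤ r) : 0 < volume (negOrthant r)ᶜ := by
  refine (aux_closed r).isOpen_compl.measure_pos volume ⟨WithLp.toLp 2 (fun _ => 1), ?_⟩
  simp only [negOrthant, Set.mem_compl_iff, Set.mem_setOf_eq, not_forall]
  exact ⟨⟨0, hr⟩, by norm_num⟩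

lemma aux_setInt_pos {r : ℕ} (s : Set (EuclideanSpace ℝ (Fin r)))
    (hs : 0 < volume s) (f : EuclideanSpace ℝ (Fin r) → ℝ) (hf : ∀ x, 0 < f x)
    (hi : Integrable f) : 0 < ∫ x in s, f x := by
  rw [integral_pos_iff_support_of_nonneg (fun x => (hf x).le) hi.integrableOn]
  have : Function.support f = Set.univ := by
    ext x; simp [(hf x).ne']
  rw [this]; simpa using hs

lemma aux_prior (r : ℕ) (hr : 1 ≤ r) (Q : Matrix (Fin r) (Fin r) ℝ) (hQ : Q.PosDef) (p : ℝ)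
    (hp : p = ∫ θ in negOrthant r,
      (2 * Real.pi) ^ (-(r:ℝ)/2) * (Q⁻¹).det ^ (-(1:ℝ)/2) *
        Real.exp (-(θ ⬝ᵥ Q.mulVec θ) / 2)) : 0 < p ∧ p < 1 := by
  have hdet := hQ.det_pos
  have hpi := Real.pi_pos
  have hdi : (Q⁻¹).det = Q.det⁻¹ := by rw [Matrix.det_nonsing_inv, Ring.inverse_eq_inv']
  set f : EuclideanSpace ℝ (Fin r) → ℝ := fun θ =>
      (2 * Real.pi) ^ (-(r:ℝ)/2) * (Q⁻¹).det ^ (-(1:ℝ)/2) *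
        Real.exp (-(θ ⬝ᵥ Q.mulVec θ) / 2) with hf
  have he : f = fun θ => (2 * Real.pi) ^ (-(r:ℝ)/2) * (Q.det⁻¹) ^ (-(1:ℝ)/2) *
        Real.exp (-((1/2) * (θ.ofLp ⬝ᵥ Q *ᵥ θ.ofLp))) := by
    ext θ; rw [hf, hdi]; simp only []; congr 2; ring
  have hpos : ∀ x, 0 < f x := by
    intro x; rw [he]; positivity
  have hint : Integrable f := by
    rw [he]; exact (aux_gauss_int r Q hQ _ (by norm_num)).const_mul _
  have htot : ∫ x, f x = 1 := by
    rw [he, integral_const_mul, aux_gauss r Q hQ _ (by norm_num), Real.inv_rpow hdet.le]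
    have h1 : Real.pi / (1/2) = 2 * Real.pi := by ring
    rw [h1, neg_div (2:ℝ) (r:ℝ), Real.rpow_neg (by positivity : 0 ≤ 2 * Real.pi)]
    have h2 : 0 < (2 * Real.pi) ^ ((r:ℝ)/2) := by positivity
    have h3 : 0 < Q.det ^ (-(1:ℝ)/2) := by positivity
    field_simp
  rw [hp]
  refine ⟨aux_setInt_pos _ (aux_vol_pos r) f hpos hint, ?_⟩
  have h4 := integral_add_compl (aux_closed r).measurableSet hint
  have h5 := aux_setInt_pos _ (aux_vol_compl_pos r hr) f hpos hint
  change ∫ x in negOrthant r, f x < 1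
  linarith

lemma aux_shift (r : ℕ) (d : ℝ) (m : EuclideanSpace ℝ (Fin r)) (S : Matrix (Fin r) (Fin r) ℝ) :
    mvtNegOrthantProb r d m S =
      ∫ ξ, (negOrthant r).indicator (fun _ => (1:ℝ)) (ξ + m) * mvtDensity r d 0 S ξ := by
  unfold mvtNegOrthantProb
  rw [← integral_indicator (aux_closed r).measurableSet, ← integral_add_right_eq_self _ m]
  congr 1; ext ξ
  have : mvtDensity r d m S (ξ + m) = mvtDensity r d 0 S ξ := by
    simp [mvtDensity]
  by_cases h : ξ + m ∈ negOrthant r <;> simp [h, this]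

lemma aux_lim (r : ℕ) (f : EuclideanSpace ℝ (Fin r) → ℝ) (hf : Integrable f)
    (θ : ℕ → EuclideanSpace ℝ (Fin r)) (l : ℝ)
    (h : ∀ ξ, ∀ᶠ k in atTop, (negOrthant r).indicator (fun _ => (1:ℝ)) (ξ + θ k) = l) :
    Tendsto (fun k => ∫ ξ, (negOrthant r).indicator (fun _ => (1:ℝ)) (ξ + θ k) * f ξ) atTop
      (nhds (l * ∫ ξ, f ξ)) := by
  rw [← integral_const_mul]
  refine tendsto_integral_of_dominated_convergence (fun x => ‖f x‖) ?_ hf.norm ?_ ?_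
  · intro k
    refine AEStronglyMeasurable.mul ?_ hf.1
    apply Measurable.aestronglyMeasurable
    exact (measurable_const.indicator (aux_closed r).measurableSet).comp (measurable_add_const _)
  · intro k
    refine Eventually.of_forall fun x => ?_
    by_cases hx : x + θ k ∈ negOrthant r <;> simp [hx]
  · refine Eventually.of_forall fun x => ?_
    refine tendsto_const_nhds.congr' ?_
    filter_upwards [h x] with k hk
    rw [hk]

/-- For the one-sided test with the adaptive g-prior (g → ∞ maximizes B01
when θ̂ ≤ 0 and B10 when θ̂ ≰ 0): the posterior of θ given g converges, as g → ∞, to the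
multivariate Student-t with location θ̂, scale (n−r2)⁻¹s_y²Q⁻¹ and n−r2 degrees of freedom
(pointwise convergence of densities); and with P(θ̂) the negative-orthant probability of
this limiting Student-t, P(θ̂) → 0 and B10 → ∞ as |θ̂| → ∞ with some coordinate of θ̂
going to +∞, while P(θ̂) → 1 and B10 → 0 as all coordinates of θ̂ go to −∞
(information consistency). -/
theorem onesided_adaptive_g_prior_information_consistent
    (n r1 r2 : ℕ) (hn : 1 ≤ n) (hr1 : 1 ≤ r1) (hdf : r2 < n)
    (Q : Matrix (Fin r1) (Fin r1) ℝ) (hQ : Q.PosDef)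
    (sysq : ℝ) (hsy : 0 < sysq)
    (Pprior : ℝ)   -- prior negative-orthant probability, determined by Q⁻¹
    (hPprior : Pprior = ∫ θ in negOrthant r1,
      (2 * Real.pi) ^ (-(r1:ℝ)/2) * (Q⁻¹).det ^ (-(1:ℝ)/2) *
        Real.exp (-(θ ⬝ᵥ Q.mulVec θ) / 2))
    (P : EuclideanSpace ℝ (Fin r1) → ℝ)
    (hP : ∀ θhat : EuclideanSpace ℝ (Fin r1),
      P θhat = mvtNegOrthantProb r1 ((n:ℝ) - r2) θhat
        ((((n:ℝ) - r2)⁻¹ * sysq) • Q⁻¹))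
    (B10 : EuclideanSpace ℝ (Fin r1) → ℝ)
    (hB10 : ∀ θhat, B10 θhat = (Pprior⁻¹ - 1)⁻¹ * ((P θhat)⁻¹ - 1)) :
    (∀ (θhat ξ : EuclideanSpace ℝ (Fin r1)),
      Tendsto (fun g : ℝ =>
          mvtDensity r1 ((n:ℝ) - r2) ((g / (g + 1)) • θhat)
            ((((sysq + (g + 1)⁻¹ * (θhat ⬝ᵥ Q.mulVec θhat)) / ((n:ℝ) - r2)) * (g / (g + 1)))
              • Q⁻¹) ξ)
        atTop
        (nhds (mvtDensity r1 ((n:ℝ) - r2) θhat ((((n:ℝ) - r2)⁻¹ * sysq) • Q⁻¹) ξ))) ∧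
    (∀ θseq : ℕ → EuclideanSpace ℝ (Fin r1),
      Tendsto (fun k => ‖θseq k‖) atTop atTop →
      (∃ i : Fin r1, Tendsto (fun k => θseq k i) atTop atTop) →
      Tendsto (fun k => P (θseq k)) atTop (nhds 0) ∧
        Tendsto (fun k => B10 (θseq k)) atTop atTop) ∧
    (∀ θseq : ℕ → EuclideanSpace ℝ (Fin r1),
      (∀ i : Fin r1, Tendsto (fun k => θseq k i) atTop atBot) →
      Tendsto (fun k => P (θseq k)) atTop (nhds 1) ∧
        Tendsto (fun k => B10 (θseq k)) atTop (nhds 0)) := by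
  have hd : (0:ℝ) < (n:ℝ) - r2 := by
    have : (r2:ℝ) < n := by exact_mod_cast hdf
    linarith
  set d : ℝ := (n:ℝ) - r2 with hd_def
  have hc : 0 < d⁻¹ * sysq := by positivity
  obtain ⟨hDi, hD1⟩ := aux_dens_int r1 d hd Q hQ _ hc
  obtain ⟨hp0, hp1⟩ := aux_prior r1 hr1 Q hQ Pprior hPprior
  have hcoef : 0 < (Pprior⁻¹ - 1)⁻¹ := by
    have := (one_lt_inv₀ hp0).2 hp1
    exact inv_pos.2 (by linarith)
  have hPs : ∀ θ, P θ = ∫ ξ, (negOrthant r1).indicator (fun _ => (1:ℝ)) (ξ + θ) *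
      mvtDensity r1 d 0 ((d⁻¹ * sysq) • Q⁻¹) ξ := fun θ => by rw [hP, aux_shift]
  have hdet := hQ.det_pos
  have hpi := Real.pi_pos
  have hDpos : ∀ m ξ, 0 < mvtDensity r1 d m ((d⁻¹ * sysq) • Q⁻¹) ξ := by
    intro m ξ
    rw [aux_dens r1 d m ξ Q hQ _ hc]
    have hG1 := Real.Gamma_pos_of_pos (half_pos hd)
    have hG2 : 0 < Real.Gamma ((d + r1) / 2) := Real.Gamma_pos_of_pos (by positivity)
    have hq := aux_quad_nonneg r1 Q hQ (ξ - m).ofLp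
    have : 0 < 1 + ((d⁻¹ * sysq)⁻¹ * ((ξ - m).ofLp ⬝ᵥ Q *ᵥ (ξ - m).ofLp)) / d := by positivity
    positivity
  have hPpos : ∀ θ, 0 < P θ := by
    intro θ
    rw [hP]
    refine aux_setInt_pos _ (aux_vol_pos r1) _ (hDpos θ) ?_
    have h1 := hDi.comp_sub_right θ
    refine h1.congr (Eventually.of_forall fun ξ => ?_)
    simp [mvtDensity]
  refine ⟨?_, ?_, ?_⟩
  · intro θ ξ
    have hg1 : Tendsto (fun g : ℝ => (g + 1)⁻¹) atTop (nhds 0) :=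
      tendsto_inv_atTop_zero.comp (tendsto_atTop_add_const_right _ 1 tendsto_id)
    have hg2 : Tendsto (fun g : ℝ => g / (g + 1)) atTop (nhds 1) := by
      have h := hg1.const_sub 1
      rw [sub_zero] at h
      refine h.congr' ?_
      filter_upwards [eventually_gt_atTop 0] with g hg
      field_simp
      ring
    have hm : Tendsto (fun g : ℝ => (g / (g + 1)) • θ) atTop (nhds θ) := by
      simpa using hg2.smul_const θ
    have hcc : Tendsto (fun g : ℝ => ((sysq + (g + 1)⁻¹ * (θ ⬝ᵥ Q.mulVec θ)) / d) * (g / (g + 1)))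
        atTop (nhds (d⁻¹ * sysq)) := by
      have h := (((hg1.mul_const (θ.ofLp ⬝ᵥ Q *ᵥ θ.ofLp)).const_add sysq).div_const d).mul hg2
      have e : (sysq + 0 * (θ.ofLp ⬝ᵥ Q *ᵥ θ.ofLp)) / d * 1 = d⁻¹ * sysq := by
        rw [zero_mul, add_zero, mul_one]; field_simp
      rw [e] at h
      exact h
    rw [aux_dens r1 d θ ξ Q hQ _ hc]
    have hq : Tendsto (fun g : ℝ => (ξ - (g / (g + 1)) • θ).ofLp ⬝ᵥ Q *ᵥ (ξ - (g / (g + 1)) • θ).ofLp)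
        atTop (nhds ((ξ - θ).ofLp ⬝ᵥ Q *ᵥ (ξ - θ).ofLp)) :=
      ((aux_quad_cont r1 Q).tendsto (ξ - θ)).comp (hm.const_sub ξ)
    have hq0 := aux_quad_nonneg r1 Q hQ (ξ - θ).ofLp
    have hbase : 0 < 1 + ((d⁻¹ * sysq)⁻¹ * ((ξ - θ).ofLp ⬝ᵥ Q *ᵥ (ξ - θ).ofLp)) / d := by positivity
    have hdd : 0 < (d⁻¹ * sysq) ^ r1 * Q.det⁻¹ := by positivity
    have hlim := ((((hcc.pow r1).mul_const Q.det⁻¹).rpow_const (p := -(1:ℝ)/2) (Or.inl hdd.ne')).const_mul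
      (Real.Gamma ((d + r1) / 2) / (Real.Gamma (d / 2) * (d * Real.pi) ^ ((r1:ℝ) / 2)))).mul
      ((((((hcc.inv₀ hc.ne').mul hq).div_const d).const_add 1)).rpow_const
        (p := -((d + (r1:ℝ)) / 2)) (Or.inl hbase.ne'))
    refine hlim.congr' ?_
    filter_upwards [hcc.eventually (lt_mem_nhds hc)] with g hg
    rw [aux_dens r1 d _ ξ Q hQ _ hg]
  · rintro θ - ⟨i, hi⟩
    have hlim : Tendsto (fun k => P (θ k)) atTop (nhds 0) := by
      have := aux_lim r1 _ hDi θ 0 (by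
        intro ξ
        filter_upwards [hi.eventually_gt_atTop (-ξ i)] with k hk
        apply Set.indicator_of_notMem
        intro h
        have := h i
        simp at this
        linarith)
      simp only [hPs]
      simpa using this
    refine ⟨hlim, ?_⟩
    have h1 : Tendsto (fun k => P (θ k)) atTop (nhdsWithin 0 (Set.Ioi 0)) :=
      tendsto_nhdsWithin_iff.2 ⟨hlim, Eventually.of_forall fun k => hPpos _⟩
    have h2 := tendsto_inv_nhdsGT_zero.comp h1
    simp only [hB10]
    refine Tendsto.const_mul_atTop hcoef ?_
    simpa [sub_eq_add_neg] using tendsto_atTop_add_const_right _ (-1) h2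
  · intro θ hθ
    have hlim : Tendsto (fun k => P (θ k)) atTop (nhds 1) := by
      have := aux_lim r1 _ hDi θ 1 (by
        intro ξ
        filter_upwards [eventually_all.2 fun i => (hθ i).eventually_le_atBot (-ξ i)] with k hk
        apply Set.indicator_of_mem
        intro i
        have := hk i
        simp
        linarith)
      simp only [hPs]
      simpa [hD1] using this
    refine ⟨hlim, ?_⟩
    have h2 := ((hlim.inv₀ one_ne_zero).sub_const 1).const_mul (Pprior⁻¹ - 1)⁻¹
    simp only [hB10]
    simpa using h2
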